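/- arXiv:2504.11387 — 2 statements merged into one kernel-verified Lean document; each statement's English description precedes it below -/
import Mathlib

section
/- Let λ, c > 0, t > 0 and let γ be a real number with |γ| < λ/c. Then the characteristic function of the telegraph meander at time t, namely e^{iγct}/(I₀(λt)+I₁(λt)) + ∫₀^{ct} e^{iγx} q_{λ,c}(x,t) dx, equals 1 + cγ(cγ+iλ) [ sinh(t√(λ²−c²γ²)) + icγ ∫₀^{t} sinh(s√(λ²−c²γ²)) I₀(λ(t−s)) ds ] / ( λ√(λ²−c²γ²)(I₀(λt)+I₁(λt)) ) + icγ [ cosh(t√(λ²−c²γ²)) − I₀(λt) + icγ ∫₀^{t} cosh(s√(λ²−c²γ²)) I₀(λ(t−s)) ds ] / ( λ(I₀(λt)+I₁(λt)) ). -/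
open Real intervalIntegral

/-- Modified Bessel function of the first kind,
`I_ν(x) = ∑_{k≥0} (x/2)^{2k+ν} / (k! Γ(ν+k+1))`. -/
noncomputable def besselI (ν x : ℝ) : ℝ :=
  ∑' k : ℕ, (x / 2) ^ (2 * (k : ℝ) + ν) / ((k.factorial : ℝ) * Real.Gamma (ν + k + 1))

/-- Absolutely continuous component of the law of the telegraph meander at its end time. -/
noncomputable def qdens (lam c x t : ℝ) : ℝ :=
  (1 / (besselI 0 (lam * t) + besselI 1 (lam * t))) *
    (lam * x * besselI 0 (lam / c * Real.sqrt (c ^ 2 * t ^ 2 - x ^ 2)) / (c * (c * t + x))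
      + besselI 1 (lam / c * Real.sqrt (c ^ 2 * t ^ 2 - x ^ 2))
          / Real.sqrt (c ^ 2 * t ^ 2 - x ^ 2)
          * (lam * x / c + (c * t - x) / (c * t + x)))

/-- The entire function `∑ zᵏ / (k! (k + n)!)`, for which `I_n(x) = (x / 2)ⁿ B_n(x² / 4)`. -/
noncomputable def besselSeries (n : ℕ) (z : ℝ) : ℝ :=
  ∑' k : ℕ, z ^ k / ((k.factorial : ℝ) * ((k + n).factorial : ℝ))

theorem summable_besselSeries (n : ℕ) (z : ℝ) :
    Summable fun k : ℕ ↦ z ^ k / ((k.factorial : ℝ) * ((k + n).factorial : ℝ)) := by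
  refine Summable.of_norm_bounded (Real.summable_pow_div_factorial |z|) fun k ↦ ?_
  rw [norm_div, norm_pow, Real.norm_eq_abs, Real.norm_of_nonneg (by positivity)]
  have h : (1 : ℝ) ≤ (k + n).factorial := by exact_mod_cast (k + n).factorial_pos
  gcongr
  exact le_mul_of_one_le_right (by positivity) h

theorem hasDerivAt_besselSeries (n : ℕ) (z : ℝ) :
    HasDerivAt (besselSeries n) (besselSeries (n + 1) z) z := by
  have hterm (k : ℕ) : ((k + 1 : ℕ) : ℝ) / (((k + 1).factorial : ℝ) * ((k + 1 + n).factorial : ℝ)) =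
      1 / ((k.factorial : ℝ) * ((k + (n + 1)).factorial : ℝ)) := by
    rw [show k + (n + 1) = k + 1 + n by ring, Nat.factorial_succ k]
    push_cast
    field_simp
  have hsum := summable_besselSeries (n + 1)
  set R : ℝ := |z| + 1
  have hu : Summable fun k : ℕ ↦
      (k : ℝ) * R ^ (k - 1) / ((k.factorial : ℝ) * ((k + n).factorial : ℝ)) := by
    rw [← summable_nat_add_iff 1]
    refine (hsum R).congr fun k ↦ ?_
    rw [Nat.add_sub_cancel, mul_div_right_comm, hterm, one_div_mul_eq_div]
  have hz : z ∈ Metric.ball (0 : ℝ) R := by simp [R]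
  have h := hasDerivAt_tsum_of_isPreconnected hu Metric.isOpen_ball
    (convex_ball (0 : ℝ) R).isPreconnected
    (g := fun k z ↦ z ^ k / ((k.factorial : ℝ) * ((k + n).factorial : ℝ)))
    (g' := fun k z ↦ (k : ℝ) * z ^ (k - 1) / ((k.factorial : ℝ) * ((k + n).factorial : ℝ)))
    (fun k y _ ↦ (hasDerivAt_pow k y).div_const _)
    (fun k y hy ↦ ?_) hz (summable_besselSeries n z) hz
  · have hs : Summable fun k : ℕ ↦
        (k : ℝ) * z ^ (k - 1) / ((k.factorial : ℝ) * ((k + n).factorial : ℝ)) := by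
      rw [← summable_nat_add_iff 1]
      refine (hsum z).congr fun k ↦ ?_
      rw [Nat.add_sub_cancel, mul_div_right_comm, hterm, one_div_mul_eq_div]
    have hval : besselSeries (n + 1) z = ∑' k : ℕ,
        (k : ℝ) * z ^ (k - 1) / ((k.factorial : ℝ) * ((k + n).factorial : ℝ)) := by
      rw [hs.tsum_eq_zero_add, besselSeries]
      simp only [Nat.cast_zero, zero_mul, zero_div, zero_add]
      refine tsum_congr fun k ↦ ?_
      rw [Nat.add_sub_cancel, mul_div_right_comm, hterm, one_div_mul_eq_div]
    rw [hval]
    exact h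
  · have hy' : |y| ≤ R := by simpa using (Metric.mem_ball.1 hy).le
    rw [norm_div, norm_mul, norm_pow, Real.norm_eq_abs y, Real.norm_of_nonneg (by positivity),
      Real.norm_of_nonneg (by positivity)]
    gcongr

theorem continuous_besselSeries (n : ℕ) : Continuous (besselSeries n) :=
  continuous_iff_continuousAt.2 fun z ↦ (hasDerivAt_besselSeries n z).continuousAt

theorem besselSeries_eq_add (n : ℕ) (z : ℝ) :
    besselSeries n z = (n + 1) * besselSeries (n + 1) z + z * besselSeries (n + 2) z := by
  have h0 := summable_besselSeries n z
  have h1 := (summable_besselSeries (n + 1) z).mul_left ((n : ℝ) + 1)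
  have h2 := (summable_besselSeries (n + 2) z).mul_left z
  rw [besselSeries, besselSeries, besselSeries, ← tsum_mul_left, ← tsum_mul_left,
    h0.tsum_eq_zero_add, h1.tsum_eq_zero_add, add_assoc,
    ← ((summable_nat_add_iff 1).2 h1).tsum_add h2]
  congr 1
  · rw [zero_add, zero_add, Nat.factorial_succ n]
    push_cast
    field_simp
  · refine tsum_congr fun k ↦ ?_
    rw [show k + 1 + (n + 1) = k + n + 1 + 1 by ring, show k + (n + 2) = k + n + 1 + 1 by ring,
      show k + 1 + n = k + n + 1 by ring, Nat.factorial_succ (k + n + 1), Nat.factorial_succ k]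
    push_cast
    field_simp
    ring

theorem besselSeries_pos (n : ℕ) {z : ℝ} (hz : 0 ≤ z) : 0 < besselSeries n z :=
  (summable_besselSeries n z).tsum_pos (fun k ↦ by positivity) 0 (by positivity)

theorem besselSeries_zero_right (n : ℕ) : besselSeries n 0 = 1 / n.factorial := by
  rw [besselSeries, tsum_eq_single 0 fun k hk ↦ by simp [hk]]
  simp

theorem besselI_natCast (n : ℕ) (x : ℝ) :
    besselI n x = (x / 2) ^ n * besselSeries n (x ^ 2 / 4) := by
  rw [besselI, besselSeries, ← tsum_mul_left]
  refine tsum_congr fun k ↦ ?_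
  rw [show (2 * (k : ℝ) + n) = ((2 * k + n : ℕ) : ℝ) by push_cast; ring, Real.rpow_natCast,
    show ((n : ℝ) + k + 1) = ((k + n : ℕ) : ℝ) + 1 by push_cast; ring, Real.Gamma_nat_eq_factorial,
    show x ^ 2 / 4 = (x / 2) ^ 2 by ring, ← pow_mul, pow_add]
  ring

theorem besselI_zero (x : ℝ) : besselI 0 x = besselSeries 0 (x ^ 2 / 4) := by
  simpa using besselI_natCast 0 x

theorem besselI_one (x : ℝ) : besselI 1 x = x / 2 * besselSeries 1 (x ^ 2 / 4) := by
  simpa using besselI_natCast 1 x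

/-- Leibniz rule for an integral over `[0, s]` whose integrand also depends on `s`. -/
theorem hasDerivAt_integral_upper_param {E : Type*} [NormedAddCommGroup E] [NormedSpace ℝ E]
    [CompleteSpace E] {f f' : ℝ → ℝ → E} (hf : Continuous f.uncurry) (hf' : Continuous f'.uncurry)
    (hd : ∀ s y, HasDerivAt (fun s ↦ f s y) (f' s y) s) (a t : ℝ) :
    HasDerivAt (fun s ↦ ∫ y in a..s, f s y) (f t t + ∫ y in a..t, f' t y) t := by
  have hfc (s : ℝ) : Continuous (f s) := hf.comp (Continuous.prodMk_right s)
  have hfc' (s : ℝ) : Continuous (f' s) := hf'.comp (Continuous.prodMk_right s)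
  have hfix : HasDerivAt (fun s ↦ ∫ y in a..t, f s y) (∫ y in a..t, f' t y) t := by
    obtain ⟨C, hC⟩ := ((isCompact_closedBall t 1).prod
      (isCompact_uIcc (a := a) (b := t))).exists_bound_of_continuousOn hf'.continuousOn
    refine (hasDerivAt_integral_of_dominated_loc_of_deriv_le (bound := fun _ ↦ C)
      (Metric.closedBall_mem_nhds t one_pos)
      (Filter.Eventually.of_forall fun s ↦ (hfc s).aestronglyMeasurable)
      ((hfc t).intervalIntegrable _ _) (hfc' t).aestronglyMeasurable
      (Filter.Eventually.of_forall fun y hy s hs ↦ ?_) intervalIntegrable_const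
      (Filter.Eventually.of_forall fun y _ s _ ↦ hd s y)).2
    exact hC (s, y) ⟨hs, Set.uIoc_subset_uIcc hy⟩
  have hmov : HasDerivAt (fun s ↦ ∫ y in t..s, f s y) (f t t) t := by
    rw [hasDerivAt_iff_isLittleO, Asymptotics.isLittleO_iff]
    intro ε hε
    obtain ⟨δ, hδ, h⟩ := Metric.continuousAt_iff.1 (hf.continuousAt (x := (t, t))) ε hε
    filter_upwards [Metric.ball_mem_nhds t hδ] with s hs
    have hconst : (s - t) • f t t = ∫ _ in t..s, f t t := by simp
    rw [integral_same, sub_zero, hconst,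
      ← integral_sub ((hfc s).intervalIntegrable _ _) intervalIntegrable_const]
    refine norm_integral_le_of_norm_le_const fun y hy ↦ ?_
    have hst : |s - t| < δ := by simpa [Real.dist_eq] using hs
    have hyt : |y - t| < δ := (Set.abs_sub_left_of_mem_uIcc (Set.uIoc_subset_uIcc hy)).trans_lt hst
    have := h (x := (s, y)) (by simpa [Prod.dist_eq, Real.dist_eq] using ⟨hst, hyt⟩)
    simpa [dist_eq_norm] using this.le
  have hsum := hmov.add hfix
  refine hsum.congr_of_eventuallyEq (Filter.Eventually.of_forall fun s ↦ ?_)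
  simp only [Pi.add_apply]
  rw [add_comm, integral_add_adjacent_intervals ((hfc s).intervalIntegrable _ _)
    ((hfc s).intervalIntegrable _ _)]

/-- Variation of constants for `G'' = ω² G + g`, `G 0 = 0`, `G' 0 = 1`. -/
theorem duhamel_sinh_cosh {ω : ℝ} {G H g : ℝ → ℂ} (hg : Continuous g)
    (hG : ∀ s, HasDerivAt G (H s) s) (hH : ∀ s, HasDerivAt H (ω ^ 2 * G s + g s) s)
    (hG0 : G 0 = 0) (hH0 : H 0 = 1) (t : ℝ) :
    ω * G t = Real.sinh (t * ω) + ∫ s in (0 : ℝ)..t, (Real.sinh (s * ω) : ℂ) * g (t - s) ∧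
      H t = Real.cosh (t * ω) + ∫ s in (0 : ℝ)..t, (Real.cosh (s * ω) : ℂ) * g (t - s) := by
  have hsinh (s : ℝ) : HasDerivAt (fun s : ℝ ↦ (Real.sinh (s * ω) : ℂ))
      ((Real.cosh (s * ω) : ℂ) * ω) s := by
    simpa using ((hasDerivAt_id s).mul_const ω).sinh.ofReal_comp
  have hcosh (s : ℝ) : HasDerivAt (fun s : ℝ ↦ (Real.cosh (s * ω) : ℂ))
      ((Real.sinh (s * ω) : ℂ) * ω) s := by
    simpa using ((hasDerivAt_id s).mul_const ω).cosh.ofReal_comp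
  have hG' (s : ℝ) : HasDerivAt (fun s ↦ G (t - s)) (-H (t - s)) s := 
    (hG (t - s)).comp_const_sub t s
  have hH' (s : ℝ) : HasDerivAt (fun s ↦ H (t - s)) (-(ω ^ 2 * G (t - s) + g (t - s))) s := 
    (hH (t - s)).comp_const_sub t s
  have h1 (s : ℝ) : HasDerivAt (fun s : ℝ ↦ -((Real.sinh (s * ω) : ℂ) * H (t - s)
      + ω * ((Real.cosh (s * ω) : ℂ) * G (t - s)))) ((Real.sinh (s * ω) : ℂ) * g (t - s)) s := by
    convert! (((hsinh s).mul (hH' s)).add (((hcosh s).mul (hG' s)).const_mul (ω : ℂ))).neg using 1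
    ring
  have h2 (s : ℝ) : HasDerivAt (fun s : ℝ ↦ -((Real.cosh (s * ω) : ℂ) * H (t - s)
      + ω * ((Real.sinh (s * ω) : ℂ) * G (t - s)))) ((Real.cosh (s * ω) : ℂ) * g (t - s)) s := by
    convert! (((hcosh s).mul (hH' s)).add (((hsinh s).mul (hG' s)).const_mul (ω : ℂ))).neg using 1
    ring
  constructor
  · rw [integral_eq_sub_of_hasDerivAt (fun s _ ↦ h1 s)
      (Continuous.intervalIntegrable (by fun_prop) _ _)]
    simp [hG0, hH0]
  · rw [integral_eq_sub_of_hasDerivAt (fun s _ ↦ h2 s)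
      (Continuous.intervalIntegrable (by fun_prop) _ _)]
    simp [hG0, hH0]

/-- `besselSeries n` on the light cone; for `n = 0` it solves `u_ss = u_yy + λ² u`. -/
noncomputable def coneBessel (lam : ℝ) (n : ℕ) (s y : ℝ) : ℝ :=
  besselSeries n (lam ^ 2 * (s ^ 2 - y ^ 2) / 4)

@[fun_prop]
theorem Continuous.coneBessel {X : Type*} [TopologicalSpace X] {f g : X → ℝ} (lam : ℝ) (n : ℕ)
    (hf : Continuous f) (hg : Continuous g) : Continuous fun x ↦ coneBessel lam n (f x) (g x) :=
  (continuous_besselSeries n).comp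
    (g := besselSeries n) (f := fun x ↦ lam ^ 2 * (f x ^ 2 - g x ^ 2) / 4) (by fun_prop)

theorem coneBessel_self (lam : ℝ) (n : ℕ) (s : ℝ) : coneBessel lam n s s = 1 / n.factorial := by
  simp [coneBessel, besselSeries_zero_right]

theorem hasDerivAt_coneBessel_left (lam : ℝ) (n : ℕ) (s y : ℝ) :
    HasDerivAt (fun s ↦ coneBessel lam n s y)
      (lam ^ 2 * s / 2 * coneBessel lam (n + 1) s y) s := by
  convert! (hasDerivAt_besselSeries n _).comp s
    (((((hasDerivAt_id s).pow 2).sub_const (y ^ 2)).const_mul (lam ^ 2)).div_const 4) using 1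
  simp only [coneBessel, id, Pi.pow_apply]
  push_cast
  ring

theorem hasDerivAt_coneBessel_right (lam : ℝ) (n : ℕ) (s y : ℝ) :
    HasDerivAt (fun y ↦ coneBessel lam n s y)
      (-(lam ^ 2 * y / 2 * coneBessel lam (n + 1) s y)) y := by
  convert! (hasDerivAt_besselSeries n _).comp y
    (((((hasDerivAt_id y).pow 2).const_sub (s ^ 2)).const_mul (lam ^ 2)).div_const 4) using 1
  simp only [coneBessel, id, Pi.pow_apply]
  push_cast
  ring

theorem hasDerivAt_cexp_I_mul (μ y : ℝ) :
    HasDerivAt (fun y : ℝ ↦ Complex.exp (Complex.I * μ * y))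
      (Complex.I * μ * Complex.exp (Complex.I * μ * y)) y := by
  have h := ((hasDerivAt_id (y : ℂ)).const_mul (Complex.I * μ)).cexp.comp_ofReal
  simpa [mul_comm] using h

/-- The transform of `u = coneBessel lam 0` over the right half of the light cone. -/
noncomputable def coneTransform (lam μ s : ℝ) : ℂ :=
  ∫ y in (0 : ℝ)..s, Complex.exp (Complex.I * μ * y) * (coneBessel lam 0 s y : ℂ)

/-- The derivative of `coneTransform` in the time variable. -/
noncomputable def coneTransformDeriv (lam μ s : ℝ) : ℂ :=
  Complex.exp (Complex.I * μ * s) + ∫ y in (0 : ℝ)..s,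
    Complex.exp (Complex.I * μ * y) * ((lam ^ 2 * s / 2 * coneBessel lam 1 s y : ℝ) : ℂ)

theorem hasDerivAt_coneTransform (lam μ s : ℝ) :
    HasDerivAt (coneTransform lam μ) (coneTransformDeriv lam μ s) s := by
  have h := hasDerivAt_integral_upper_param
    (f := fun s y ↦ Complex.exp (Complex.I * μ * y) * (coneBessel lam 0 s y : ℂ))
    (f' := fun s y ↦
      Complex.exp (Complex.I * μ * y) * ((lam ^ 2 * s / 2 * coneBessel lam 1 s y : ℝ) : ℂ))
    (by simp only [Function.uncurry_def]; fun_prop)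
    (by simp only [Function.uncurry_def]; fun_prop)
    (fun s y ↦ (hasDerivAt_coneBessel_left lam 0 s y).ofReal_comp.const_mul _) 0 s
  convert! h using 1
  simp [coneBessel_self, coneTransformDeriv]

theorem hasDerivAt_coneTransformDeriv (lam μ s : ℝ) :
    HasDerivAt (coneTransformDeriv lam μ)
      (((lam ^ 2 - μ ^ 2 : ℝ) : ℂ) * coneTransform lam μ s
        + Complex.I * μ * (coneBessel lam 0 s 0 : ℂ)) s := by
  have h := (hasDerivAt_cexp_I_mul μ s).add (hasDerivAt_integral_upper_param
    (f := fun s y ↦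
      Complex.exp (Complex.I * μ * y) * ((lam ^ 2 * s / 2 * coneBessel lam 1 s y : ℝ) : ℂ))
    (f' := fun s y ↦ Complex.exp (Complex.I * μ * y) *
      ((lam ^ 2 / 2 * coneBessel lam 1 s y
        + lam ^ 2 * s / 2 * (lam ^ 2 * s / 2 * coneBessel lam 2 s y) : ℝ) : ℂ))
    (by simp only [Function.uncurry_def]; fun_prop)
    (by simp only [Function.uncurry_def]; fun_prop)
    (fun s y ↦ by
      refine HasDerivAt.const_mul _ (HasDerivAt.ofReal_comp ?_)
      convert! (((hasDerivAt_id s).const_mul (lam ^ 2)).div_const 2).mul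
        (hasDerivAt_coneBessel_left lam 1 s y) using 1
      simp) 0 s)
  have hanti (y : ℝ) : HasDerivAt (fun y : ℝ ↦ Complex.exp (Complex.I * μ * y) *
      (((-(lam ^ 2 * y / 2 * coneBessel lam 1 s y) : ℝ) : ℂ)
        - Complex.I * μ * (coneBessel lam 0 s y : ℂ)))
      (Complex.exp (Complex.I * μ * y) *
        ((lam ^ 2 / 2 * coneBessel lam 1 s y
          + lam ^ 2 * s / 2 * (lam ^ 2 * s / 2 * coneBessel lam 2 s y) : ℝ) : ℂ)
      - ((lam ^ 2 - μ ^ 2 : ℝ) : ℂ) *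
        (Complex.exp (Complex.I * μ * y) * (coneBessel lam 0 s y : ℂ))) y := by
    have hder := (hasDerivAt_cexp_I_mul μ y).mul
      (((((((hasDerivAt_id y).const_mul (lam ^ 2)).div_const 2).mul
        (hasDerivAt_coneBessel_right lam 1 s y)).neg).ofReal_comp).sub
        ((hasDerivAt_coneBessel_right lam 0 s y).ofReal_comp.const_mul (Complex.I * μ)))
    convert! hder using 1
    have hrec : (coneBessel lam 0 s y : ℂ) = coneBessel lam 1 s y
        + lam ^ 2 * (s ^ 2 - y ^ 2) / 4 * coneBessel lam 2 s y := by
      have := besselSeries_eq_add 0 (lam ^ 2 * (s ^ 2 - y ^ 2) / 4)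
      simp only [coneBessel]
      rw [this]
      push_cast
      ring
    simp only [id, zero_add, one_add_one_eq_two, Pi.mul_apply, Pi.sub_apply, Pi.neg_apply]
    push_cast
    rw [hrec]
    linear_combination (μ : ℂ) ^ 2 * Complex.exp (Complex.I * μ * y) * (coneBessel lam 1 s y
        + lam ^ 2 * (s ^ 2 - y ^ 2) / 4 * coneBessel lam 2 s y) * Complex.I_sq
  have hint := integral_eq_sub_of_hasDerivAt (a := 0) (b := s) (fun y _ ↦ hanti y)
    (Continuous.intervalIntegrable (by fun_prop) _ _)
  rw [integral_sub
    (Continuous.intervalIntegrable (by fun_prop) _ _)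
    (Continuous.intervalIntegrable (by fun_prop) _ _),
    integral_const_mul, ← coneTransform] at hint
  convert! h using 1
  rw [sub_eq_iff_eq_add] at hint
  rw [hint]
  simp only [coneBessel_self]
  push_cast
  simp
  ring

theorem coneTransform_duhamel {lam μ ω : ℝ} (hω : ω ^ 2 = lam ^ 2 - μ ^ 2) (t : ℝ) :
    ω * coneTransform lam μ t = Real.sinh (t * ω) + Complex.I * μ *
        ((∫ s in (0 : ℝ)..t, Real.sinh (s * ω) * besselI 0 (lam * (t - s)) : ℝ) : ℂ) ∧
      coneTransformDeriv lam μ t = Real.cosh (t * ω) + Complex.I * μ *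
        ((∫ s in (0 : ℝ)..t, Real.cosh (s * ω) * besselI 0 (lam * (t - s)) : ℝ) : ℂ) := by
  have hb (s : ℝ) : besselI 0 (lam * s) = coneBessel lam 0 s 0 := by
    rw [besselI_zero, coneBessel]
    ring_nf
  have h := duhamel_sinh_cosh (ω := ω) (g := fun s ↦ Complex.I * μ * (coneBessel lam 0 s 0 : ℂ))
    (by fun_prop) (hasDerivAt_coneTransform lam μ)
    (fun s ↦ by
      have := hasDerivAt_coneTransformDeriv lam μ s
      rwa [← hω, Complex.ofReal_pow] at this)
    (by simp [coneTransform]) (by simp [coneTransformDeriv]) t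
  simp only [hb, ← integral_ofReal, ← integral_const_mul]
  convert! h using 5 <;> push_cast <;> ring

/-- The density of the meander integrated against `exp (i μ y)`, in terms of `coneTransform`. -/
theorem integral_meander_kernel {lam t : ℝ} (μ : ℝ) (ht : 0 < t) :
    lam * ∫ y in (0 : ℝ)..t, Complex.exp (Complex.I * μ * y) *
        ((lam * y / (t + y) * coneBessel lam 0 t y
          + lam / 2 * coneBessel lam 1 t y * (lam * y + (t - y) / (t + y)) : ℝ) : ℂ)
      = μ * (μ + Complex.I * lam) * coneTransform lam μ t
        + Complex.I * μ * (coneTransformDeriv lam μ t - coneBessel lam 0 t 0)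
        - lam * Complex.exp (Complex.I * μ * t) + lam * coneBessel lam 0 t 0
        + lam ^ 2 * t / 2 * coneBessel lam 1 t 0 := by
  have hpos {y : ℝ} (hy : y ∈ Set.uIcc 0 t) : t + y ≠ 0 := by
    rw [Set.uIcc_of_le ht.le] at hy
    linarith [hy.1]
  have hanti (y : ℝ) (hy : y ∈ Set.uIcc 0 t) : HasDerivAt (fun y : ℝ ↦
      Complex.exp (Complex.I * μ * y) * ((Complex.I * μ - lam) * (coneBessel lam 0 t y : ℂ)
        - ((lam ^ 2 / 2 * ((t - y) * coneBessel lam 1 t y) : ℝ) : ℂ)))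
      (lam * (Complex.exp (Complex.I * μ * y) *
          ((lam * y / (t + y) * coneBessel lam 0 t y
            + lam / 2 * coneBessel lam 1 t y * (lam * y + (t - y) / (t + y)) : ℝ) : ℂ))
        - μ * (μ + Complex.I * lam) *
          (Complex.exp (Complex.I * μ * y) * (coneBessel lam 0 t y : ℂ))
        - Complex.I * μ * (Complex.exp (Complex.I * μ * y) *
          ((lam ^ 2 * t / 2 * coneBessel lam 1 t y : ℝ) : ℂ))) y := by
    have hder := (hasDerivAt_cexp_I_mul μ y).mul
      (((hasDerivAt_coneBessel_right lam 0 t y).ofReal_comp.const_mul (Complex.I * μ - lam)).sub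
        ((((hasDerivAt_id y).const_sub t).mul
          (hasDerivAt_coneBessel_right lam 1 t y)).const_mul (lam ^ 2 / 2)).ofReal_comp)
    convert! hder using 1
    have hne : (t : ℂ) + y ≠ 0 := by exact_mod_cast hpos hy
    have hrec : (coneBessel lam 0 t y : ℂ) = coneBessel lam 1 t y
        + lam ^ 2 * (t ^ 2 - y ^ 2) / 4 * coneBessel lam 2 t y := by
      have := besselSeries_eq_add 0 (lam ^ 2 * (t ^ 2 - y ^ 2) / 4)
      simp only [coneBessel]
      rw [this]
      push_cast
      ring
    simp only [id, zero_add, one_add_one_eq_two, Pi.mul_apply, Pi.sub_apply]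
    push_cast
    rw [hrec]
    field_simp
    ring_nf
    simp only [Complex.I_sq]
    ring
  have hK : ContinuousOn (fun y : ℝ ↦ Complex.exp (Complex.I * μ * y) *
      ((lam * y / (t + y) * coneBessel lam 0 t y
        + lam / 2 * coneBessel lam 1 t y * (lam * y + (t - y) / (t + y)) : ℝ) : ℂ))
      (Set.uIcc 0 t) := by
    refine ContinuousOn.mul (by fun_prop) (Complex.continuous_ofReal.comp_continuousOn ?_)
    fun_prop (disch := exact fun y hy ↦ hpos hy)
  have hK' := hK.intervalIntegrable (μ := MeasureTheory.volume)
  have hu : IntervalIntegrable (fun y : ℝ ↦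
      Complex.exp (Complex.I * μ * y) * (coneBessel lam 0 t y : ℂ)) MeasureTheory.volume 0 t :=
    Continuous.intervalIntegrable (by fun_prop) _ _
  have hv : IntervalIntegrable (fun y : ℝ ↦ Complex.exp (Complex.I * μ * y) *
      ((lam ^ 2 * t / 2 * coneBessel lam 1 t y : ℝ) : ℂ)) MeasureTheory.volume 0 t :=
    Continuous.intervalIntegrable (by fun_prop) _ _
  have hint := integral_eq_sub_of_hasDerivAt hanti
    (((hK'.const_mul _).sub (hu.const_mul _)).sub (hv.const_mul _))
  rw [integral_sub ((hK'.const_mul _).sub (hu.const_mul _)) (hv.const_mul _),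
    integral_sub (hK'.const_mul _) (hu.const_mul _), integral_const_mul, integral_const_mul,
    integral_const_mul, ← coneTransform] at hint
  have hH : (∫ y in (0 : ℝ)..t, Complex.exp (Complex.I * μ * y) *
      ((lam ^ 2 * t / 2 * coneBessel lam 1 t y : ℝ) : ℂ))
      = coneTransformDeriv lam μ t - Complex.exp (Complex.I * μ * t) := by
    rw [coneTransformDeriv]
    ring
  rw [hH] at hint
  simp only [coneBessel_self] at hint
  push_cast at hint
  simp only [Nat.factorial_zero, Nat.cast_one, div_one, mul_zero, Complex.exp_zero, one_mul,
    sub_self, zero_mul, sub_zero, mul_one] at hint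
  push_cast
  linear_combination hint

/-- The density `qdens` at `c y`, expressed through the power series of the Bessel functions. -/
theorem mul_qdens_mul {lam c t y : ℝ} (hc : 0 < c) (hy : 0 < y) (hyt : y < t) :
    c * qdens lam c (c * y) t =
      (1 / (besselI 0 (lam * t) + besselI 1 (lam * t))) *
        (lam * y / (t + y) * coneBessel lam 0 t y
          + lam / 2 * coneBessel lam 1 t y * (lam * y + (t - y) / (t + y))) := by
  have hpos : 0 < t ^ 2 - y ^ 2 := by nlinarith
  have hr : Real.sqrt (c ^ 2 * t ^ 2 - (c * y) ^ 2) = c * Real.sqrt (t ^ 2 - y ^ 2) := by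
    rw [show c ^ 2 * t ^ 2 - (c * y) ^ 2 = c ^ 2 * (t ^ 2 - y ^ 2) by ring,
      Real.sqrt_mul (sq_nonneg c), Real.sqrt_sq hc.le]
  have hr0 : 0 < Real.sqrt (t ^ 2 - y ^ 2) := Real.sqrt_pos.2 hpos
  have harg : lam / c * (c * Real.sqrt (t ^ 2 - y ^ 2)) = lam * Real.sqrt (t ^ 2 - y ^ 2) := by
    field_simp
  have hz : (lam * Real.sqrt (t ^ 2 - y ^ 2)) ^ 2 / 4 = lam ^ 2 * (t ^ 2 - y ^ 2) / 4 := by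
    rw [mul_pow, Real.sq_sqrt hpos.le]
  have hty : t + y ≠ 0 := by linarith
  have hcty : c * t + c * y ≠ 0 := by rw [← mul_add]; exact mul_ne_zero hc.ne' hty
  rw [qdens, hr, harg, besselI_zero (lam * Real.sqrt _), besselI_one (lam * Real.sqrt _), hz,
    ← coneBessel, ← coneBessel, show c * t + c * y = c * (t + y) by ring,
    show c * t - c * y = c * (t - y) by ring]
  field_simp

theorem integral_cexp_mul_qdens {lam c t : ℝ} (γ : ℝ) (hc : 0 < c) (ht : 0 < t) :
    (∫ x in (0 : ℝ)..(c * t), Complex.exp (Complex.I * γ * x) * (qdens lam c x t : ℂ))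
      = (∫ y in (0 : ℝ)..t, Complex.exp (Complex.I * (c * γ : ℝ) * y) *
        ((lam * y / (t + y) * coneBessel lam 0 t y
          + lam / 2 * coneBessel lam 1 t y * (lam * y + (t - y) / (t + y)) : ℝ) : ℂ)) /
        ((besselI 0 (lam * t) + besselI 1 (lam * t) : ℝ) : ℂ) := by
  have h := intervalIntegral.smul_integral_comp_mul_left (a := 0) (b := t)
    (fun x : ℝ ↦ Complex.exp (Complex.I * γ * x) * (qdens lam c x t : ℂ)) c
  rw [mul_zero] at h
  rw [← h, ← intervalIntegral.integral_smul, ← intervalIntegral.integral_div]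
  refine intervalIntegral.integral_congr_Ioo_of_le ht.le fun y hy ↦ ?_
  have hq := congrArg (fun r : ℝ ↦ (r : ℂ)) (mul_qdens_mul (lam := lam) hc hy.1 hy.2)
  simp only [Complex.ofReal_mul c (qdens _ _ _ _)] at hq
  have he : Complex.I * ((c * γ : ℝ) : ℂ) * y = Complex.I * γ * ((c * y : ℝ) : ℂ) := by
    push_cast
    ring
  simp only [Complex.real_smul]
  rw [mul_left_comm, hq, one_div_mul_eq_div, Complex.ofReal_div, he]
  exact (mul_div_assoc _ _ _).symm

theorem stmt_6 (lam c t γ : ℝ) (hlam : 0 < lam) (hc : 0 < c) (ht : 0 < t)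
    (hγ : |γ| < lam / c) :
    Complex.exp (Complex.I * γ * (c * t)) /
        ((besselI 0 (lam * t) + besselI 1 (lam * t) : ℝ) : ℂ)
      + (∫ x in (0:ℝ)..(c * t), Complex.exp (Complex.I * γ * x) * (qdens lam c x t : ℂ))
    = 1
      + (c : ℂ) * γ * ((c : ℂ) * γ + Complex.I * lam) *
          (((Real.sinh (t * Real.sqrt (lam ^ 2 - c ^ 2 * γ ^ 2)) : ℝ) : ℂ)
            + Complex.I * c * γ *
              ((∫ s in (0:ℝ)..t,
                  Real.sinh (s * Real.sqrt (lam ^ 2 - c ^ 2 * γ ^ 2))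
                    * besselI 0 (lam * (t - s)) : ℝ) : ℂ)) /
          ((lam * Real.sqrt (lam ^ 2 - c ^ 2 * γ ^ 2) *
              (besselI 0 (lam * t) + besselI 1 (lam * t)) : ℝ) : ℂ)
      + Complex.I * c * γ *
          (((Real.cosh (t * Real.sqrt (lam ^ 2 - c ^ 2 * γ ^ 2))
                - besselI 0 (lam * t) : ℝ) : ℂ)
            + Complex.I * c * γ *
              ((∫ s in (0:ℝ)..t,
                  Real.cosh (s * Real.sqrt (lam ^ 2 - c ^ 2 * γ ^ 2))
                    * besselI 0 (lam * (t - s)) : ℝ) : ℂ)) /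
          ((lam * (besselI 0 (lam * t) + besselI 1 (lam * t)) : ℝ) : ℂ) := by
  have hpos : 0 < lam ^ 2 - c ^ 2 * γ ^ 2 := by
    rw [lt_div_iff₀ hc] at hγ
    have := pow_lt_pow_left₀ hγ (by positivity) two_ne_zero
    rw [mul_pow, sq_abs] at this
    linarith
  have hω0 := Real.sqrt_pos.2 hpos
  have hω : Real.sqrt (lam ^ 2 - c ^ 2 * γ ^ 2) ^ 2 = lam ^ 2 - (c * γ) ^ 2 := by
    rw [Real.sq_sqrt hpos.le]
    ring
  set ω := Real.sqrt (lam ^ 2 - c ^ 2 * γ ^ 2)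
  have hz : (lam * t) ^ 2 / 4 = lam ^ 2 * (t ^ 2 - 0 ^ 2) / 4 := by ring
  have hI0 : besselI 0 (lam * t) = coneBessel lam 0 t 0 := by rw [besselI_zero, hz, coneBessel]
  have hI1 : besselI 1 (lam * t) = lam * t / 2 * coneBessel lam 1 t 0 := by
    rw [besselI_one, hz, coneBessel]
  have hD0 : 0 < besselI 0 (lam * t) + besselI 1 (lam * t) := by
    rw [besselI_zero, besselI_one]
    have h0 := besselSeries_pos 0 (z := (lam * t) ^ 2 / 4) (by positivity)
    have h1 := besselSeries_pos 1 (z := (lam * t) ^ 2 / 4) (by positivity)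
    positivity
  obtain ⟨hsinh, hcosh⟩ := coneTransform_duhamel hω t
  have hK := integral_meander_kernel (lam := lam) (c * γ) ht
  have hD : ((besselI 0 (lam * t) + besselI 1 (lam * t) : ℝ) : ℂ)
      = coneBessel lam 0 t 0 + lam * t / 2 * coneBessel lam 1 t 0 := by
    rw [hI0, hI1]
    push_cast
    ring
  have hDC : ((besselI 0 (lam * t) + besselI 1 (lam * t) : ℝ) : ℂ) ≠ 0 := by
    exact_mod_cast hD0.ne'
  have hlamC : (lam : ℂ) ≠ 0 := by exact_mod_cast hlam.ne'
  have hωC : (ω : ℂ) ≠ 0 := by exact_mod_cast hω0.ne'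
  have he : Complex.I * γ * (c * t) = Complex.I * ((c * γ : ℝ) : ℂ) * t := by
    push_cast
    ring
  rw [integral_cexp_mul_qdens γ hc ht, he, Complex.ofReal_mul (lam * ω), Complex.ofReal_mul lam ω,
    Complex.ofReal_mul lam, Complex.ofReal_sub, hI0]
  rw [hI0] at hD hDC
  set D : ℂ := ((coneBessel lam 0 t 0 + besselI 1 (lam * t) : ℝ) : ℂ)
  have hμ : ((c * γ : ℝ) : ℂ) = c * γ := by push_cast; ring
  set K := ∫ y in (0 : ℝ)..t, Complex.exp (Complex.I * ((c * γ : ℝ) : ℂ) * y) *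
        ((lam * y / (t + y) * coneBessel lam 0 t y
          + lam / 2 * coneBessel lam 1 t y * (lam * y + (t - y) / (t + y)) : ℝ) : ℂ)
  rw [hμ] at hsinh hcosh hK ⊢
  rw [show ∀ a b : ℂ, a + Complex.I * c * γ * b = a + Complex.I * (c * γ) * b by
      intros; ring, ← hsinh]
  rw [hcosh] at hK
  generalize Complex.exp (Complex.I * (c * γ) * t) = e at hK ⊢
  generalize (∫ s in (0 : ℝ)..t, Real.cosh (s * ω) * besselI 0 (lam * (t - s))) = C at hK ⊢
  generalize Real.cosh (t * ω) = ch at hK ⊢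
  field_simp
  linear_combination hK - (lam : ℂ) * hD
end

section
/- Let λ, c > 0, t > 0 and p > 0. Then ∫₀^{ct} x^p I₀((λ/c)√(c²t²−x²)) dx = (Γ((p+1)/2)/2) (2c²t/λ)^{(p+1)/2} I_{(p+1)/2}(λt). -/
open Real intervalIntegral

/-- The moments of `(a² - x²)^k` on `[0, a]`, a form of the Beta integral. -/
lemma integral_rpow_mul_sq_sub_sq_pow {a : ℝ} (ha : 0 < a) (k : ℕ) {q : ℝ} (hq : 0 < q) :
    ∫ x in (0:ℝ)..a, x ^ q * (a ^ 2 - x ^ 2) ^ k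
      = a ^ (q + 1) * a ^ (2 * k) * (k.factorial : ℝ) * Real.Gamma ((q + 1) / 2) /
          (2 * Real.Gamma ((q + 1) / 2 + k + 1)) := by
  induction k generalizing q with
  | zero =>
    have hs : 0 < (q + 1) / 2 := by positivity
    have hG := (Real.Gamma_pos_of_pos hs).ne'
    simp only [pow_zero, mul_one, Nat.factorial_zero, Nat.cast_one, Nat.cast_zero, add_zero,
      mul_zero]
    rw [integral_rpow (Or.inl (by linarith)), Real.zero_rpow (by positivity),
      Real.Gamma_add_one hs.ne']
    field_simp
    ring
  | succ k ih =>
    have hcont : ∀ r : ℝ, 0 < r → IntervalIntegrable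
        (fun x : ℝ => x ^ r * (a ^ 2 - x ^ 2) ^ k) MeasureTheory.volume 0 a := fun r hr =>
      ((Real.continuous_rpow_const hr.le).mul (by fun_prop)).intervalIntegrable _ _
    have hsplit : ∫ x in (0:ℝ)..a, x ^ q * (a ^ 2 - x ^ 2) ^ (k + 1)
        = a ^ 2 * (∫ x in (0:ℝ)..a, x ^ q * (a ^ 2 - x ^ 2) ^ k)
          - ∫ x in (0:ℝ)..a, x ^ (q + 2) * (a ^ 2 - x ^ 2) ^ k := by
      rw [← intervalIntegral.integral_const_mul,
        ← intervalIntegral.integral_sub ((hcont q hq).const_mul _) (hcont (q + 2) (by positivity))]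
      refine intervalIntegral.integral_congr fun x hx => ?_
      rw [Set.uIcc_of_le ha.le] at hx
      have h2 : x ^ (q + 2) = x ^ q * x ^ 2 := by
        rw [Real.rpow_add_of_nonneg hx.1 hq.le zero_le_two, Real.rpow_two]
      simp only [h2]
      ring
    have hs : 0 < (q + 1) / 2 := by positivity
    have hsk : 0 < (q + 1) / 2 + k + 1 := by positivity
    have hG := (Real.Gamma_pos_of_pos hsk).ne'
    have ha2 : a ^ (q + 2 + 1) = a ^ (q + 1) * a ^ 2 := by
      rw [← Real.rpow_two, ← Real.rpow_add ha]
      ring_nf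
    have hshift : (q + 2 + 1) / 2 = (q + 1) / 2 + 1 := by ring
    have hshift' : (q + 1) / 2 + 1 + k + 1 = (q + 1) / 2 + k + 1 + 1 := by ring
    rw [hsplit, ih hq, ih (by positivity), ha2, hshift, hshift', Nat.cast_succ, ← add_assoc,
      Real.Gamma_add_one hsk.ne', Real.Gamma_add_one hs.ne', Nat.factorial_succ]
    generalize (q + 1) / 2 = s at *
    push_cast
    field_simp
    ring

lemma besselI_zero_term (y : ℝ) (k : ℕ) :
    (y / 2) ^ (2 * (k : ℝ) + 0) / ((k.factorial : ℝ) * Real.Gamma (0 + k + 1))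
      = (y ^ 2 / 4) ^ k / (k.factorial : ℝ) ^ 2 := by
  have h : 2 * (k : ℝ) + 0 = ((2 * k : ℕ) : ℝ) := by push_cast; ring
  rw [h, Real.rpow_natCast, zero_add, Real.Gamma_nat_eq_factorial, pow_mul, div_pow, sq
    (k.factorial : ℝ)]
  norm_num

lemma summable_pow_div_factorial_sq (z : ℝ) :
    Summable fun k : ℕ => z ^ k / (k.factorial : ℝ) ^ 2 := by
  refine Summable.of_norm_bounded (Real.summable_pow_div_factorial |z|) fun k => ?_
  rw [norm_div, norm_pow, norm_pow, Real.norm_eq_abs, RCLike.norm_natCast]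
  have h1 : (1 : ℝ) ≤ k.factorial := by exact_mod_cast k.factorial_pos
  gcongr
  exact le_self_pow₀ h1 two_ne_zero

theorem stmt_8 (lam c t p : ℝ) (hlam : 0 < lam) (hc : 0 < c) (ht : 0 < t)
    (hp : 0 < p) :
    ∫ x in (0:ℝ)..(c * t),
        x ^ p * besselI 0 (lam / c * Real.sqrt (c ^ 2 * t ^ 2 - x ^ 2))
      = Real.Gamma ((p + 1) / 2) / 2 * (2 * c ^ 2 * t / lam) ^ ((p + 1) / 2) *
          besselI ((p + 1) / 2) (lam * t) := by
  have ha : 0 < c * t := mul_pos hc ht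
  set b : ℝ := lam ^ 2 / c ^ 2 / 4 with hb
  have hb0 : 0 ≤ b := by positivity
  let F : ℕ → ℝ → ℝ := fun k x =>
    b ^ k / (k.factorial : ℝ) ^ 2 * (x ^ p * ((c * t) ^ 2 - x ^ 2) ^ k)
  have hF : HasSum (fun k => ∫ x in (0:ℝ)..(c * t), F k x)
      (∫ x in (0:ℝ)..(c * t),
        x ^ p * besselI 0 (lam / c * Real.sqrt (c ^ 2 * t ^ 2 - x ^ 2))) := by
    refine intervalIntegral.hasSum_integral_of_dominated_convergence
      (fun k _ => (c * t) ^ p * ((b * (c * t) ^ 2) ^ k / (k.factorial : ℝ) ^ 2))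
      (fun k => ?_) (fun k => ?_) ?_ ?_ ?_
    · exact (continuous_const.mul ((Real.continuous_rpow_const hp.le).mul
        (by fun_prop))).aestronglyMeasurable
    · refine Filter.Eventually.of_forall fun x hx => ?_
      rw [Set.uIoc_of_le ha.le] at hx
      have hx0 : 0 ≤ x := hx.1.le
      have hd : 0 ≤ (c * t) ^ 2 - x ^ 2 := sub_nonneg.2 (pow_le_pow_left₀ hx0 hx.2 2)
      have hd' : (c * t) ^ 2 - x ^ 2 ≤ (c * t) ^ 2 := sub_le_self _ (sq_nonneg x)
      have hpow : x ^ p ≤ (c * t) ^ p := Real.rpow_le_rpow hx0 hx.2 hp.le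
      rw [Real.norm_of_nonneg (by positivity)]
      calc F k x ≤ b ^ k / (k.factorial : ℝ) ^ 2 * ((c * t) ^ p * ((c * t) ^ 2) ^ k) := by
            dsimp only [F]
            gcongr
        _ = _ := by rw [mul_pow b]; ring
    · exact Filter.Eventually.of_forall fun x _ =>
        (summable_pow_div_factorial_sq _).mul_left _
    · exact intervalIntegrable_const
    · refine Filter.Eventually.of_forall fun x hx => ?_
      rw [Set.uIoc_of_le ha.le] at hx
      have hd : 0 ≤ c ^ 2 * t ^ 2 - x ^ 2 := by
        rw [← mul_pow]
        exact sub_nonneg.2 (pow_le_pow_left₀ hx.1.le hx.2 2)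
      have hy : (lam / c * Real.sqrt (c ^ 2 * t ^ 2 - x ^ 2)) ^ 2 / 4
          = b * ((c * t) ^ 2 - x ^ 2) := by
        rw [mul_pow, Real.sq_sqrt hd, hb]
        ring
      unfold besselI
      simp only [besselI_zero_term, hy]
      have hFx : (fun k => F k x) = fun k : ℕ =>
          x ^ p * ((b * ((c * t) ^ 2 - x ^ 2)) ^ k / (k.factorial : ℝ) ^ 2) := by
        funext k
        dsimp only [F]
        rw [mul_pow b]
        ring
      rw [hFx]
      exact (summable_pow_div_factorial_sq _).hasSum.mul_left (x ^ p)
  rw [← hF.tsum_eq, besselI, ← tsum_mul_left]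
  refine tsum_congr fun k => ?_
  have hs : 0 < (p + 1) / 2 := by positivity
  have hG := (Real.Gamma_pos_of_pos (show 0 < (p + 1) / 2 + k + 1 by positivity)).ne'
  have hk : (k.factorial : ℝ) ≠ 0 := by exact_mod_cast k.factorial_ne_zero
  have hpow : (c * t) ^ (p + 1)
      = (2 * c ^ 2 * t / lam) ^ ((p + 1) / 2) * (lam * t / 2) ^ ((p + 1) / 2) := by
    rw [← Real.mul_rpow (by positivity) (by positivity),
      show 2 * c ^ 2 * t / lam * (lam * t / 2) = (c * t) ^ (2 : ℝ) by
        rw [Real.rpow_two]; field_simp,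
      ← Real.rpow_mul ha.le]
    ring_nf
  have hexp : (lam * t / 2) ^ (2 * (k : ℝ) + (p + 1) / 2)
      = b ^ k * (c * t) ^ (2 * k) * (lam * t / 2) ^ ((p + 1) / 2) := by
    rw [Real.rpow_add (by positivity), show 2 * (k : ℝ) = ((2 * k : ℕ) : ℝ) by push_cast; ring,
      Real.rpow_natCast, pow_mul, pow_mul, ← mul_pow]
    congr 2
    rw [hb]
    field_simp
    norm_num
  dsimp only [F]
  rw [intervalIntegral.integral_const_mul, integral_rpow_mul_sq_sub_sq_pow ha k hp, hpow, hexp]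
  field_simp
end
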